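/- Let (X_θ, S) be the minimal bounded speedup of Example 3.1: θ(a) = ab, θ(b) = aa on {a,b}, A = {x ∈ X_θ : (x_0,…,x_7) = (a,b,a,a,a,b,a,b)}, p = 3 on A, p = 1 on σ(A), p = 2 elsewhere, and S(x) = σ^{p(x)}(x). Let φ be the substitution on B = {w₁,w₂,w₃,w₄} with φ(w₁) = w₁w₂w₃w₄, φ(w₂) = w₁w₂w₄w₃, φ(w₃) = w₁w₂w₃w₄w₃, φ(w₄) = w₁w₂w₄, and let ψ : B → {A,B,C,D,E}⁺ be given by ψ(w₁) = ABCCCBCBDBEE, ψ(w₂) = ABCCDBEEEBEB, ψ(w₃) = ABCCCBCBDBEEEBEB, ψ(w₄) = ABCCDBEE. For y ∈ X_φ let ψ(y) ∈ {A,B,C,D,E}^ℤ denote the bi-infinite concatenation …ψ(y₋₁)ψ(y₀)ψ(y₁)… with ψ(y₀) beginning at coordinate 0, and let Y be the closure of {σ^n(ψ(y)) : y ∈ X_φ, n ∈ ℤ}. Then (X_θ, S) is topologically conjugate to (Y, σ). -/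

import Mathlib

open Set Topology Classical

noncomputable section

/-- The left shift `σ` on bi-infinite sequences: `(σ x) n = x (n+1)`. -/
def shiftMap {A : Type} (x : ℤ → A) : ℤ → A := fun n => x (n + 1)

/-- The shift by an integer amount: `shiftZ n x = σ^n x`. -/
def shiftZ {A : Type} (n : ℤ) (x : ℤ → A) : ℤ → A := fun m => x (m + n)

/-- A bi-infinite sequence is Toeplitz if every coordinate is periodically repeated. -/
def IsToeplitz {A : Type} (x : ℤ → A) : Prop :=
  ∀ i : ℤ, ∃ p : ℕ, 0 < p ∧ ∀ k : ℤ, x (i + k * (p : ℤ)) = x i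

/-- The closure of the full shift orbit of `x`. -/
def orbitClosure {A : Type} [TopologicalSpace A] (x : ℤ → A) : Set (ℤ → A) :=
  closure {y | ∃ n : ℤ, shiftZ n x = y}

/-- The finite word `x_i x_{i+1} ⋯ x_{i+n-1}`. -/
def seqWord {A : Type} (x : ℤ → A) (i : ℤ) (n : ℕ) : List A :=
  List.ofFn fun m : Fin n => x (i + (m : ℕ))

/-- Iterates `θ^k` of a substitution, applied to a letter. -/
def substPow {A : Type} (θ : A → List A) : ℕ → A → List A
  | 0, a => [a]
  | k + 1, a => (θ a).flatMap (substPow θ k)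

/-- The substitution subshift of `θ`: all sequences whose finite subwords occur in
some `θ^k(a)`. -/
def substShift {A : Type} (θ : A → List A) : Set (ℤ → A) :=
  {x | ∀ i : ℤ, ∀ n : ℕ, ∃ (k : ℕ) (a : A), (seqWord x i n).IsInfix (substPow θ k a)}

/-- The full orbit of `x` under an (invertible) map `S`, within the set `X`. -/
def orbitIn {α : Type} (S : α → α) (X : Set α) (x : α) : Set α :=
  {y | y ∈ X ∧ ∃ n : ℕ, S^[n] x = y ∨ S^[n] y = x}

/-- Every `S`-orbit within `X` is dense in `X`. -/
def MinimalOn {α : Type} [TopologicalSpace α] (S : α → α) (X : Set α) : Prop :=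
  ∀ x ∈ X, X ⊆ closure (orbitIn S X x)

/-- Every `T`-orbit in `X` is the union of exactly `c` distinct `S`-orbits. -/
def OrbitNumberOn {α : Type} (T S : α → α) (X : Set α) (c : ℕ) : Prop :=
  ∀ x ∈ X, ∃ r : Fin c → α,
    (∀ i, r i ∈ orbitIn T X x) ∧
    (∀ i j, i ≠ j → r j ∉ orbitIn S X (r i)) ∧
    (∀ y ∈ orbitIn T X x, ∃ i, y ∈ orbitIn S X (r i))

/-- `S` restricts to a homeomorphism of the subset `X`. -/
def RestrictsToHomeomorph {α : Type} [TopologicalSpace α] (S : α → α) (X : Set α) : Prop :=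
  ∃ e : X ≃ₜ X, ∀ x : X, (e x : α) = S (x : α)

/-- The systems `(X, S)` and `(Y, R)` are topologically conjugate. -/
def TopConj {α β : Type} [TopologicalSpace α] [TopologicalSpace β]
    (X : Set α) (S : α → α) (Y : Set β) (R : β → β) : Prop :=
  ∃ (hS : Set.MapsTo S X X) (hR : Set.MapsTo R Y Y) (h : X ≃ₜ Y),
    ∀ x : X, h (Set.MapsTo.restrict S X X hS x) = Set.MapsTo.restrict R Y Y hR (h x)

/-- `(Y, R)` is a topological factor of `(X, S)`. -/
def IsFactorOn {α β : Type} [TopologicalSpace α] [TopologicalSpace β]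
    (X : Set α) (S : α → α) (Y : Set β) (R : β → β) : Prop :=
  ∃ F : α → β, Set.MapsTo F X Y ∧ ContinuousOn F X ∧ Set.SurjOn F X Y ∧
    ∀ x ∈ X, F (S x) = R (F x)

/-- `(X, S)` is a Toeplitz flow: it is topologically conjugate to the orbit closure of
some Toeplitz sequence over some finite alphabet, with the shift map. -/
def IsToeplitzFlow {α : Type} [TopologicalSpace α] (X : Set α) (S : α → α) : Prop :=
  ∃ (B : Type) (_ : Fintype B) (z : ℤ → B), IsToeplitz z ∧
    (letI : TopologicalSpace B := ⊥
     TopConj X S (orbitClosure z) shiftMap)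

/-- `Per_p(x)`: the set of positions where `x` is periodic with period `p`. -/
def PerSet {A : Type} (x : ℤ → A) (p : ℕ) : Set ℤ :=
  {k | ∀ n : ℤ, x (k + n * (p : ℤ)) = x k}

/-- `p` is an essential period of `x`. -/
def IsEssentialPeriod {A : Type} (x : ℤ → A) (p : ℕ) : Prop :=
  0 < p ∧ ¬ ∃ q : ℕ, 0 < q ∧ q < p ∧
    ((fun k => k + (q : ℤ)) '' PerSet x p = PerSet x p) ∧
    (∀ k ∈ PerSet x p, x (k + (q : ℤ)) = x k)

/-- A period structure for a Toeplitz sequence `x`. -/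
def IsPeriodStructure {A : Type} (x : ℤ → A) (p : ℕ → ℕ) : Prop :=
  StrictMono p ∧ (∀ k, IsEssentialPeriod x (p k)) ∧
  (∀ k, p k ∣ p (k + 1)) ∧ (⋃ k, PerSet x (p k)) = Set.univ

/-- `x` is a (σ-)periodic sequence. -/
def IsPeriodicSeq {A : Type} (x : ℤ → A) : Prop :=
  ∃ n : ℕ, 0 < n ∧ ∀ m : ℤ, x (m + (n : ℤ)) = x m

/-- `z` is the bi-infinite concatenation of the `ψ`-images of the letters of `y`,
with `ψ(y₀)` beginning at coordinate `0`. -/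
def IsConcat {B C : Type} (ψ : B → List C) (y : ℤ → B) (z : ℤ → C) : Prop :=
  ∃ s : ℤ → ℤ, s 0 = 0 ∧
    (∀ n : ℤ, s (n + 1) = s n + ((ψ (y n)).length : ℤ)) ∧
    (∀ n : ℤ, ∀ j : Fin (ψ (y n)).length, z (s n + (j : ℕ)) = (ψ (y n)).get j)

/-- `p(x,n) = Σ_{i<n} p(Sⁱ x)`. -/
def psum {X : Type} (p : X → ℕ) (S : X → X) (x : X) (n : ℕ) : ℕ :=
  ∑ i ∈ Finset.range n, p (S^[i] x)


/-- The substitution θ(a) = ab, θ(b) = aa on the alphabet {a, b} = Fin 2 (a = 0, b = 1). -/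
def theta : Fin 2 → List (Fin 2) := fun i => if i = 0 then [0, 1] else [0, 0]

/-- The cylinder set A = [θ³(a)] = {x ∈ X_θ : x₀…x₇ = abaaabab}. -/
def Aset : Set (ℤ → Fin 2) :=
  {x | x ∈ substShift theta ∧ seqWord x 0 8 = [0, 1, 0, 0, 0, 1, 0, 1]}

open scoped Classical in
/-- The jump function: p = 3 on A, p = 1 on σ(A), p = 2 elsewhere. -/
noncomputable def jump (x : ℤ → Fin 2) : ℕ :=
  if x ∈ Aset then 3 else if x ∈ shiftMap '' Aset then 1 else 2

/-- The speedup map S(x) = σ^{p(x)}(x). -/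
noncomputable def Sspeed (x : ℤ → Fin 2) : ℤ → Fin 2 := shiftMap^[jump x] x

/-- The substitution φ on B = {w₁, w₂, w₃, w₄} = Fin 4 (wᵢ = i - 1). -/
def phi : Fin 4 → List (Fin 4) := fun i =>
  if i = 0 then [0, 1, 2, 3]
  else if i = 1 then [0, 1, 3, 2]
  else if i = 2 then [0, 1, 2, 3, 2]
  else [0, 1, 3]

/-- The map ψ : B → {A,B,C,D,E}⁺ (letters A,…,E = 0,…,4). -/
def psi : Fin 4 → List (Fin 5) := fun i =>
  if i = 0 then [0, 1, 2, 2, 2, 1, 2, 1, 3, 1, 4, 4]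
  else if i = 1 then [0, 1, 2, 2, 3, 1, 4, 4, 4, 1, 4, 1]
  else if i = 2 then [0, 1, 2, 2, 2, 1, 2, 1, 3, 1, 4, 4, 4, 1, 4, 1]
  else [0, 1, 2, 2, 3, 1, 4, 4]

/-- Y: the closure of {σⁿ(ψ(y)) : y ∈ X_φ, n ∈ ℤ}. -/
def Yspace : Set (ℤ → Fin 5) :=
  closure {z | ∃ y ∈ substShift phi, ∃ w : ℤ → Fin 5,
    IsConcat psi y w ∧ ∃ n : ℤ, z = shiftZ n w}

/-! ### Words and concatenations -/

theorem seqWord_length {A : Type} (x : ℤ → A) (i : ℤ) (n : ℕ) : (seqWord x i n).length = n := by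
  simp [seqWord]

theorem seqWord_get {A : Type} (x : ℤ → A) (i : ℤ) (n j : ℕ) (h : j < (seqWord x i n).length) :
    (seqWord x i n)[j] = x (i + j) := by
  simp [seqWord]

theorem seqWord_add {A : Type} (x : ℤ → A) (i : ℤ) (m n : ℕ) :
    seqWord x i (m + n) = seqWord x i m ++ seqWord x (i + m) n := by
  apply List.ext_getElem
  · simp [seqWord_length]
  · intro k h1 h2
    rw [seqWord_get, List.getElem_append]
    split_ifs with h
    · rw [seqWord_get]
    · rw [seqWord_get]
      congr 1
      simp only [seqWord_length] at h ⊢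
      omega

theorem seqWord_one {A : Type} (x : ℤ → A) (i : ℤ) : seqWord x i 1 = [x i] := by
  simp [seqWord]

theorem seqWord_succ {A : Type} (x : ℤ → A) (i : ℤ) (n : ℕ) :
    seqWord x i (n + 1) = x i :: seqWord x (i + 1) n := by
  rw [add_comm n 1, seqWord_add, seqWord_one]
  simp

theorem seqWord_shiftZ {A : Type} (x : ℤ → A) (k i : ℤ) (n : ℕ) :
    seqWord (shiftZ k x) i n = seqWord x (i + k) n := by
  simp only [seqWord, shiftZ]
  congr 1
  funext m
  congr 1
  ring

/-- A sub-interval word is an infix. -/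
theorem seqWord_isub {A : Type} (x : ℤ → A) (i j : ℤ) (m n : ℕ) (h1 : j ≤ i)
    (h2 : i + m ≤ j + n) : seqWord x i m <:+: seqWord x j n := by
  obtain ⟨a, rfl⟩ : ∃ a : ℕ, i = j + a := ⟨(i - j).toNat, by omega⟩
  obtain ⟨b, rfl⟩ : ∃ b : ℕ, n = a + m + b := ⟨n - (a + m), by omega⟩
  rw [seqWord_add, seqWord_add]
  exact ⟨_, _, rfl⟩

theorem seqWord_eq_iff {A : Type} (x : ℤ → A) (i : ℤ) (l : List A) :
    seqWord x i l.length = l ↔ ∀ j (h : j < l.length), x (i + (j : ℕ)) = l[j] := by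
  constructor
  · intro h j hj
    have := seqWord_get x i l.length j (by rw [seqWord_length]; exact hj)
    rw [← this]
    simp only [h]
  · intro h
    apply List.ext_getElem
    · simp [seqWord_length]
    · intro k h1 h2
      rw [seqWord_get, h]

/-- Concatenation with explicit cut positions. -/
def ConcatS {B C : Type} (ψ : B → List C) (y : ℤ → B) (z : ℤ → C) (s : ℤ → ℤ) : Prop :=
  s 0 = 0 ∧ (∀ n : ℤ, s (n + 1) = s n + ((ψ (y n)).length : ℤ)) ∧
    (∀ n : ℤ, seqWord z (s n) (ψ (y n)).length = ψ (y n))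

theorem isConcat_iff {B C : Type} (ψ : B → List C) (y : ℤ → B) (z : ℤ → C) :
    IsConcat ψ y z ↔ ∃ s, ConcatS ψ y z s := by
  unfold IsConcat ConcatS
  simp only [seqWord_eq_iff]
  constructor
  · rintro ⟨s, h0, h1, h2⟩
    exact ⟨s, h0, h1, fun n j hj => h2 n ⟨j, hj⟩⟩
  · rintro ⟨s, h0, h1, h2⟩
    exact ⟨s, h0, h1, fun n j => h2 n j j.2⟩

section concat
variable {B C : Type} {ψ : B → List C} {y : ℤ → B} {z : ℤ → C} {s : ℤ → ℤ}

theorem ConcatS.pos_add (h : ConcatS ψ y z s) (i : ℤ) (n : ℕ) :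
    s (i + n) = s i + (((seqWord y i n).flatMap ψ).length : ℤ) := by
  induction n with
  | zero => simp [seqWord]
  | succ n ih =>
    rw [seqWord_add, seqWord_one, List.flatMap_append, List.length_append]
    push_cast
    rw [← add_assoc, h.2.1, ih]
    simp
    ring

theorem ConcatS.word (h : ConcatS ψ y z s) (i : ℤ) (n : ℕ) :
    seqWord z (s i) ((seqWord y i n).flatMap ψ).length = (seqWord y i n).flatMap ψ := by
  induction n with
  | zero => simp [seqWord]
  | succ n ih =>
    rw [seqWord_add, seqWord_one, List.flatMap_append, List.length_append, seqWord_add, ih,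
      ← h.pos_add]
    simp [h.2.2]

theorem ConcatS.strict (h : ConcatS ψ y z s) (hψ : ∀ b, ψ b ≠ []) (n : ℤ) : s n < s (n + 1) := by
  have := h.2.1 n
  have := List.length_pos_iff.2 (hψ (y n))
  omega

theorem grow_nonneg {s : ℤ → ℤ} (hs : ∀ n, s n < s (n + 1)) (i : ℤ) (n : ℕ) :
    s i + n ≤ s (i + n) := by
  induction n with
  | zero => simp
  | succ n ih =>
    have := hs (i + n)
    push_cast
    rw [← add_assoc, ← add_assoc]
    omega

theorem grow_le {s : ℤ → ℤ} (hs : ∀ n, s n < s (n + 1)) {i j : ℤ} (hij : i ≤ j) :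
    s i + (j - i) ≤ s j := by
  have := grow_nonneg hs i (j - i).toNat
  have e : ((j - i).toNat : ℤ) = j - i := by omega
  rw [e] at this
  simpa using this

theorem exists_cut {s : ℤ → ℤ} (hs : ∀ n, s n < s (n + 1)) (h0 : s 0 = 0) (m : ℤ) :
    ∃ n, s n ≤ m ∧ m < s (n + 1) ∧ |n| ≤ |m| := by
  obtain ⟨n, hn, hmax⟩ := Int.exists_greatest_of_bdd (P := fun n => s n ≤ m)
    ⟨|m|, by
      intro n hn
      by_contra hc
      have h1 := grow_le hs (i := 0) (j := n) (by have := abs_nonneg m; omega)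
      have := le_abs_self m
      omega⟩
    ⟨-|m|, by
      have h1 := grow_le hs (i := -|m|) (j := 0) (by have := abs_nonneg m; omega)
      have := neg_abs_le m
      omega⟩
  have h2 : m < s (n + 1) := by
    by_contra hc
    have := hmax (n + 1) (by omega)
    omega
  refine ⟨n, hn, h2, ?_⟩
  by_cases hn0 : 0 ≤ n
  · have h1 := grow_le hs hn0
    rw [abs_of_nonneg hn0]
    have := le_abs_self m
    omega
  · have h1 := grow_le hs (i := n + 1) (j := 0) (by omega)
    rw [abs_of_neg (by omega)]
    have := neg_abs_le m
    omega

theorem cut_unique {s : ℤ → ℤ} (hs : ∀ n, s n < s (n + 1)) {m n n' : ℤ}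
    (h1 : s n ≤ m) (h2 : m < s (n + 1)) (h3 : s n' ≤ m) (h4 : m < s (n' + 1)) : n = n' := by
  by_contra hc
  rcases lt_or_gt_of_ne hc with h | h
  · have := grow_le hs (i := n + 1) (j := n') (by omega)
    omega
  · have := grow_le hs (i := n' + 1) (j := n) (by omega)
    omega

theorem exists_sums (f : ℤ → ℤ) : ∃ s : ℤ → ℤ, s 0 = 0 ∧ ∀ n, s (n + 1) = s n + f n := by
  refine ⟨fun n => (∑ i ∈ Finset.range n.toNat, f i) -
    ∑ i ∈ Finset.range (-n).toNat, f (-i - 1), by simp, ?_⟩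
  intro n
  rcases le_or_gt 0 n with h | h
  · obtain ⟨k, rfl⟩ := Int.eq_ofNat_of_zero_le h
    have e1 : (-((k : ℤ) + 1)).toNat = 0 := by omega
    have e2 : ((k : ℤ) + 1).toNat = k + 1 := by omega
    have e3 : (-(k : ℤ)).toNat = 0 := by omega
    have e4 : (k : ℤ).toNat = k := by omega
    simp only [e1, e2, e3, e4, Finset.sum_range_succ, Finset.range_zero, Finset.sum_empty]
    ring
  · obtain ⟨k, rfl⟩ : ∃ k : ℕ, n = -(k : ℤ) - 1 := ⟨(-n - 1).toNat, by omega⟩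
    have e1 : (-(-(k : ℤ) - 1 + 1)).toNat = k := by omega
    have e2 : (-(k : ℤ) - 1 + 1).toNat = 0 := by omega
    have e3 : (-(-(k : ℤ) - 1)).toNat = k + 1 := by omega
    have e4 : (-(k : ℤ) - 1).toNat = 0 := by omega
    simp only [e1, e2, e3, e4, Finset.sum_range_succ, Finset.range_zero, Finset.sum_empty]
    ring

theorem exists_concat (hψ : ∀ b, ψ b ≠ []) (y : ℤ → B) : ∃ z s, ConcatS ψ y z s := by
  obtain ⟨s, h0, hs⟩ := exists_sums (fun n => ((ψ (y n)).length : ℤ))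
  have hst : ∀ n, s n < s (n + 1) := by
    intro n
    have := hs n
    have := List.length_pos_iff.2 (hψ (y n))
    omega
  choose n h1 h2 _ using exists_cut hst h0
  refine ⟨fun m => (ψ (y (n m)))[(m - s (n m)).toNat]'(by
    have := hs (n m); have := h1 m; have := h2 m; omega), s, h0, hs, ?_⟩
  intro k
  rw [seqWord_eq_iff]
  intro j hj
  have hk := hs k
  have e : n (s k + j) = k := cut_unique hst (h1 (s k + j)) (h2 (s k + j)) (by omega)
    (by omega)
  have key : ∀ (a : ℤ) (t : ℕ) (hh : t < (ψ (y a)).length), a = k → t = j →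
      (ψ (y a))[t] = (ψ (y k))[j] := by
    intro a t hh ha ht
    subst ha; subst ht; rfl
  apply key _ _ _ e
  rw [e]; omega

theorem seqWord_congr {A : Type} {x x' : ℤ → A} {i : ℤ} {n : ℕ}
    (h : ∀ j, i ≤ j → j < i + n → x j = x' j) : seqWord x i n = seqWord x' i n := by
  simp only [seqWord]
  congr 1
  funext m
  apply h <;> omega

/-- Locality of concatenation. -/
theorem ConcatS.agree {y' : ℤ → B} {z' : ℤ → C} {s' : ℤ → ℤ} (hψ : ∀ b, ψ b ≠ [])
    (h : ConcatS ψ y z s) (h' : ConcatS ψ y' z' s') (N : ℤ)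
    (hyy : ∀ i, |i| ≤ N → y i = y' i) : ∀ i, |i| ≤ N → z i = z' i := by
  have hpos : ∀ n : ℤ, |n| ≤ N → s n = s' n := by
    intro n hn
    rcases le_or_gt 0 n with h0 | h0
    · obtain ⟨k, rfl⟩ := Int.eq_ofNat_of_zero_le h0
      have a := h.pos_add 0 k
      have b := h'.pos_add 0 k
      rw [seqWord_congr (x' := y')] at a
      · rw [h.1] at a
        rw [h'.1] at b
        rw [zero_add] at a b
        omega
      · intro j h1 h2
        apply hyy
        rw [abs_of_nonneg h0] at hn
        rw [abs_of_nonneg h1]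
        omega
    · obtain ⟨k, rfl⟩ : ∃ k : ℕ, n = -(k : ℤ) := ⟨(-n).toNat, by omega⟩
      have a := h.pos_add (-k) k
      have b := h'.pos_add (-k) k
      rw [seqWord_congr (x' := y')] at a
      · simp only [neg_add_cancel, h.1, h'.1] at a b
        omega
      · intro j h1 h2
        apply hyy
        rw [abs_of_neg h0] at hn
        rw [abs_of_nonpos (by omega)]
        omega
  intro m hm
  obtain ⟨n, h1, h2, h3⟩ := exists_cut (h.strict hψ) h.1 m
  have hn : |n| ≤ N := h3.trans hm
  have e := hpos n hn
  have w := h.2.2 n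
  have w' := h'.2.2 n
  rw [← e, ← hyy n hn] at w'
  rw [seqWord_eq_iff] at w w'
  have hl := h.2.1 n
  have a := w (m - s n).toNat (by omega)
  have b := w' (m - s n).toNat (by omega)
  have e2 : s n + ((m - s n).toNat : ℕ) = m := by omega
  rw [e2] at a b
  rw [a, b]

theorem ConcatS.unique {z' : ℤ → C} {s' : ℤ → ℤ} (hψ : ∀ b, ψ b ≠ [])
    (h : ConcatS ψ y z s) (h' : ConcatS ψ y z' s') : z = z' := by
  funext i
  exact h.agree hψ h' |i| (fun _ _ => rfl) i le_rfl

theorem ConcatS.shift (h : ConcatS ψ y z s) (n : ℤ) :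
    ConcatS ψ (shiftZ n y) (shiftZ (s n) z) (fun m => s (m + n) - s n) := by
  refine ⟨by simp, fun m => ?_, fun m => ?_⟩
  · have := h.2.1 (m + n)
    simp only [shiftZ]
    rw [show m + 1 + n = m + n + 1 by ring]
    omega
  · rw [seqWord_shiftZ]
    simpa [shiftZ] using h.2.2 (m + n)

theorem ConcatS.cover (hψ : ∀ b, ψ b ≠ []) (h : ConcatS ψ y z s) (i : ℤ) (n : ℕ) :
    ∃ i' n', seqWord z i n <:+: (seqWord y i' n').flatMap ψ := by
  have hst := h.strict hψ
  let K : ℕ := i.natAbs + n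
  refine ⟨-K, 2 * K, ?_⟩
  rw [← h.word]
  have h1 := grow_le hst (i := -(K : ℤ)) (j := 0) (by omega)
  have h2 := grow_le hst (i := 0) (j := (K : ℤ)) (by omega)
  have h3 := h.pos_add (-K) (2 * K)
  have e : -(K : ℤ) + ((2 * K : ℕ) : ℤ) = K := by push_cast; ring
  rw [e] at h3
  have h0 := h.1
  apply seqWord_isub
  · omega
  · omega

end concat

/-! ### Locally determined sets -/

theorem isOpen_of_local {k : ℕ} (U : Set (ℤ → Fin k)) (N : ℤ)
    (hU : ∀ x y : ℤ → Fin k, (∀ i, |i| ≤ N → x i = y i) → x ∈ U → y ∈ U) : IsOpen U := by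
  rw [isOpen_iff_mem_nhds]
  intro x hx
  have hopen : IsOpen {y : ℤ → Fin k | ∀ i ∈ Set.Icc (-N) N, y i = x i} := by
    have : {y : ℤ → Fin k | ∀ i ∈ Set.Icc (-N) N, y i = x i}
        = ⋂ i ∈ Set.Icc (-N) N, (fun y : ℤ → Fin k => y i) ⁻¹' {x i} := by
      ext y; simp
    rw [this]
    apply (Set.finite_Icc (-N) N).isOpen_biInter
    intro i _
    exact (isOpen_discrete _).preimage (continuous_apply i)
  refine Filter.mem_of_superset (hopen.mem_nhds (by intro i _; rfl)) ?_
  intro y hy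
  exact hU x y (fun i hi => (hy i (abs_le.1 hi)).symm) hx

theorem isClosed_of_local {k : ℕ} (U : Set (ℤ → Fin k)) (N : ℤ)
    (hU : ∀ x y : ℤ → Fin k, (∀ i, |i| ≤ N → x i = y i) → x ∈ U → y ∈ U) : IsClosed U := by
  rw [← isOpen_compl_iff]
  apply isOpen_of_local _ N
  intro x y hxy hx hy
  exact hx (hU y x (fun i hi => (hxy i hi).symm) hy)

theorem isClosed_word {k : ℕ} (i : ℤ) (n : ℕ) (P : List (Fin k) → Prop) :
    IsClosed {x : ℤ → Fin k | P (seqWord x i n)} := by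
  apply isClosed_of_local _ (|i| + n)
  intro x y hxy hx
  have : seqWord x i n = seqWord y i n := by
    apply seqWord_congr
    intro j h1 h2
    apply hxy
    have := le_abs_self i
    have := neg_abs_le i
    rw [abs_le]; omega
  simpa [this] using hx

theorem isClosed_substShift {k : ℕ} (θ : Fin k → List (Fin k)) : IsClosed (substShift θ) := by
  have : substShift θ = ⋂ (i : ℤ) (n : ℕ), {x : ℤ → Fin k |
      ∃ (m : ℕ) (a : Fin k), (seqWord x i n).IsInfix (substPow θ m a)} := by
    ext x; simp [substShift]
  rw [this]
  exact isClosed_iInter fun i => isClosed_iInter fun n =>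
    isClosed_word i n (fun w => ∃ (m : ℕ) (a : Fin k), w.IsInfix (substPow θ m a))

theorem substShift_shiftZ {A : Type} {θ : A → List A} {x : ℤ → A} (hx : x ∈ substShift θ) (k : ℤ) :
    shiftZ k x ∈ substShift θ := by
  intro i n
  rw [seqWord_shiftZ]
  exact hx _ _

theorem shiftMap_eq {A : Type} (x : ℤ → A) : shiftMap x = shiftZ 1 x := rfl

theorem shiftZ_shiftZ {A : Type} (x : ℤ → A) (a b : ℤ) :
    shiftZ a (shiftZ b x) = shiftZ (a + b) x := by
  funext m
  simp [shiftZ, add_assoc]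

theorem shiftZ_zero {A : Type} (x : ℤ → A) : shiftZ 0 x = x := by
  funext m
  simp [shiftZ]

theorem shiftMap_iterate {A : Type} (x : ℤ → A) (n : ℕ) : shiftMap^[n] x = shiftZ n x := by
  induction n with
  | zero => simp [shiftZ_zero]
  | succ n ih =>
    rw [Function.iterate_succ_apply', ih, shiftMap_eq, shiftZ_shiftZ]
    push_cast; rw [add_comm]

/-! ### The coding maps and combinatorics of words -/

/-- The decoding map ρ: A ↦ aba, B ↦ aa, C ↦ ba, D ↦ b, E ↦ ab. -/
def rho : Fin 5 → List (Fin 2) := ![[0, 1, 0], [0, 0], [1, 0], [1], [0, 1]]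

/-- The map τ with θ³ ∘ τ = ρ ∘ ψ. -/
def tau : Fin 4 → List (Fin 2) := ![[0, 1, 0], [0, 0, 1], [0, 1, 0, 1], [0, 0]]

theorem rho_ne (b : Fin 5) : rho b ≠ [] := by revert b; decide

theorem psi_ne (b : Fin 4) : psi b ≠ [] := by revert b; decide

theorem substPow_add {A : Type} (θ : A → List A) (j k : ℕ) (a : A) :
    substPow θ (j + k) a = (substPow θ j a).flatMap (substPow θ k) := by
  induction j generalizing a with
  | zero => simp [substPow]
  | succ j ih =>
    rw [show j + 1 + k = (j + k) + 1 by ring, substPow, substPow, List.flatMap_assoc]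
    congr 1
    funext b
    exact ih b

theorem flatMap_isub {A B : Type} {u v : List A} (f : A → List B) (h : u <:+: v) :
    u.flatMap f <:+: v.flatMap f := by
  obtain ⟨s, t, rfl⟩ := h
  exact ⟨s.flatMap f, t.flatMap f, by simp⟩

theorem tau_phi (b : Fin 4) : (phi b).flatMap tau = (tau b).flatMap (substPow theta 2) := by
  revert b; decide

theorem rho_psi (b : Fin 4) : (psi b).flatMap rho = (tau b).flatMap (substPow theta 3) := by
  revert b; decide

theorem tau_phi_pow (k : ℕ) (b : Fin 4) :
    (substPow phi k b).flatMap tau = (tau b).flatMap (substPow theta (2 * k)) := by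
  induction k generalizing b with
  | zero => simp [substPow]
  | succ k ih =>
    rw [substPow, List.flatMap_assoc]
    simp only [ih]
    rw [← List.flatMap_assoc, tau_phi, List.flatMap_assoc]
    congr 1
    funext c
    rw [← substPow_add]
    congr 1; ring

theorem rho_psi_word (u : List (Fin 4)) :
    (u.flatMap psi).flatMap rho = (u.flatMap tau).flatMap (substPow theta 3) := by
  rw [List.flatMap_assoc, List.flatMap_assoc]
  congr 1
  funext b
  exact rho_psi b

theorem rho_psi_pow (k : ℕ) (b : Fin 4) :
    ((substPow phi k b).flatMap psi).flatMap rho =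
      (tau b).flatMap (substPow theta (2 * k + 3)) := by
  rw [rho_psi_word, tau_phi_pow, List.flatMap_assoc]
  congr 1
  funext c
  rw [← substPow_add]

theorem tau_isub (b : Fin 4) : tau b <:+: substPow theta 3 0 := by
  revert b; decide

theorem mem_theta_pow (j : ℕ) (c : Fin 2) : [c] <:+: substPow theta (j + 1) 0 := by
  induction j generalizing c with
  | zero => revert c; decide
  | succ j ih =>
    have h := flatMap_isub theta (ih 0)
    have e : (substPow theta (j + 1) 0).flatMap theta = substPow theta (j + 1 + 1) 0 := by
      rw [substPow_add theta (j + 1) 1]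
      congr 1
      funext c
      simp [substPow]
    rw [e] at h
    refine List.IsInfix.trans ?_ h
    revert c; decide

theorem theta_pow_isub (m : ℕ) (c : Fin 2) :
    substPow theta m c <:+: substPow theta (2 * m + 3) 0 := by
  have h := flatMap_isub (substPow theta m) (mem_theta_pow (m + 2) c)
  rw [← substPow_add, show m + 2 + 1 + m = 2 * m + 3 by ring] at h
  simpa using h

/-- The state change. -/
def nx (s : Bool) (c : Fin 2) : Bool := if c = 0 then !s else s

/-- The block of length four coding one level three letter. -/
def blk (s : Bool) (c : Fin 2) : List (Fin 5) :=
  if c = 0 then (if s then [3, 1, 4, 4] else [0, 1, 2, 2])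
  else (if s then [2, 1, 2, 1] else [4, 1, 4, 1])

/-- State after reading a word. -/
def stt : Bool → List (Fin 2) → Bool
  | s, [] => s
  | s, c :: v => stt (nx s c) v

/-- The coding of a word of level three letters. -/
def FF : Bool → List (Fin 2) → List (Fin 5)
  | _, [] => []
  | s, c :: v => blk s c ++ FF (nx s c) v

/-- The offset word. -/
def offw (s : Bool) : List (Fin 2) := if s then [0] else []

theorem stt_append (s : Bool) (u v : List (Fin 2)) : stt s (u ++ v) = stt (stt s u) v := by
  induction u generalizing s with
  | nil => rfl
  | cons c u ih => simp [stt, ih]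

theorem FF_append (s : Bool) (u v : List (Fin 2)) : FF s (u ++ v) = FF s u ++ FF (stt s u) v := by
  induction u generalizing s with
  | nil => rfl
  | cons c u ih => simp [stt, FF, ih]

theorem psi_eq_FF (b : Fin 4) : psi b = FF false (tau b) ∧ stt false (tau b) = false := by
  revert b; decide

theorem FF_tau (u : List (Fin 4)) : FF false (u.flatMap tau) = u.flatMap psi := by
  induction u with
  | nil => rfl
  | cons b u ih =>
    rw [List.flatMap_cons, List.flatMap_cons, FF_append, (psi_eq_FF b).2, ih, ← (psi_eq_FF b).1]

theorem stt_theta (n : ℕ) : ∀ s, stt s (substPow theta n 0) = !s ∧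
    stt s (substPow theta n 1) = s := by
  induction n with
  | zero => decide
  | succ n ih =>
    intro s
    have e0 : substPow theta (n + 1) 0 = substPow theta n 0 ++ substPow theta n 1 := by
      simp [substPow, theta]
    have e1 : substPow theta (n + 1) 1 = substPow theta n 0 ++ substPow theta n 0 := by
      simp [substPow, theta]
    rw [e0, e1, stt_append, stt_append]
    simp [ih]

theorem rho_FF (s : Bool) (v : List (Fin 2)) :
    offw s ++ (FF s v).flatMap rho = v.flatMap (substPow theta 3) ++ offw (stt s v) := by
  induction v generalizing s with
  | nil => simp [FF, stt]
  | cons c v ih =>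
    have h : offw s ++ (blk s c).flatMap rho = substPow theta 3 c ++ offw (nx s c) := by
      revert s c; decide
    rw [FF, List.flatMap_append, ← List.append_assoc, h, List.append_assoc, ih, List.flatMap_cons,
      List.append_assoc, stt]

/-- Every position is a cut position for one of the two states. -/
theorem exists_cut_word (v : List (Fin 2)) (P : ℕ)
    (hP : P < (v.flatMap (substPow theta 3)).length) :
    ∃ s q, q <+: FF s v ∧ (offw s ++ q.flatMap rho).length = P := by
  induction v generalizing P with
  | nil => simp at hP
  | cons c v ih =>
    have hlen : (substPow theta 3 c).length = 8 := by
      clear hP; revert c; decide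
    rcases lt_or_ge P 8 with h | h
    · have key : ∀ c : Fin 2, ∀ P < 8, ∃ s : Bool, ∃ n < 4,
          (offw s ++ ((blk s c).take n).flatMap rho).length = P := by decide
      obtain ⟨s, n, _, hn⟩ := key c P h
      refine ⟨s, (blk s c).take n, ?_, hn⟩
      rw [FF]
      exact (show _ <+: _ from ⟨_, List.take_append_drop _ _⟩ : List.take n (blk s c) <+: blk s c).trans (List.prefix_append _ _)
    · rw [List.flatMap_cons, List.length_append, hlen] at hP
      obtain ⟨s', q, hq, hl⟩ := ih (P - 8) (by omega)
      have key : ∀ (c : Fin 2) (s' : Bool), ∃ s, nx s c = s' ∧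
          (offw s ++ (blk s c).flatMap rho).length = 8 + (offw s').length := by decide
      obtain ⟨s, rfl, hs⟩ := key c s'
      refine ⟨s, blk s c ++ q, ?_, ?_⟩
      · rw [FF]
        exact List.prefix_append_right_inj _ |>.2 hq
      · rw [List.flatMap_append, ← List.append_assoc, List.length_append, hs]
        rw [List.length_append] at hl
        omega

/-- Both states occur in ψ(φ^k(w₁)). -/
theorem exists_start (k P : ℕ) (hP : P < (substPow theta (2 * k + 3) 0).length) :
    ∃ q e r, q <+: (substPow phi k 0).flatMap psi ∧
      ((substPow phi k 0).flatMap psi).flatMap rho = e ++ substPow theta (2 * k + 3) 0 ++ r ∧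
      (q.flatMap rho).length = e.length + P := by
  set v := substPow theta (2 * k) 0 with hv
  set vb := substPow theta (2 * k) 1 with hvb
  have hV : substPow theta (2 * k + 3) 0 = v.flatMap (substPow theta 3) := by
    rw [hv, ← substPow_add]
  have hVb : substPow theta (2 * k + 3) 1 = vb.flatMap (substPow theta 3) := by
    rw [hvb, ← substPow_add]
  have hW : (substPow phi k 0).flatMap psi = FF false (v ++ vb ++ v) := by
    rw [← FF_tau, tau_phi_pow]
    simp [tau, ← hv, ← hvb]
  have hR : ((substPow phi k 0).flatMap psi).flatMap rho =
      substPow theta (2 * k + 3) 0 ++ substPow theta (2 * k + 3) 1 ++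
        substPow theta (2 * k + 3) 0 := by
    rw [rho_psi_pow]
    simp [tau]
  have hst : stt false (v ++ vb) = true := by
    rw [stt_append, (stt_theta _ _).1, (stt_theta _ _).2]; rfl
  obtain ⟨s, q, hq, hl⟩ := exists_cut_word v P (by rw [← hV]; exact hP)
  cases s with
  | false =>
    refine ⟨q, [], substPow theta (2 * k + 3) 1 ++ substPow theta (2 * k + 3) 0, ?_, ?_, ?_⟩
    · rw [hW, List.append_assoc, FF_append]
      exact hq.trans (List.prefix_append _ _)
    · rw [hR]; simp
    · simpa [offw] using hl
  | true =>
    refine ⟨FF false (v ++ vb) ++ q, substPow theta (2 * k + 3) 0 ++ substPow theta (2 * k + 3) 1,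
      [], ?_, ?_, ?_⟩
    · rw [hW, FF_append false (v ++ vb) v, hst]
      exact List.prefix_append_right_inj _ |>.2 hq
    · rw [hR]; simp
    · have h := congrArg List.length (rho_FF false (v ++ vb))
      rw [hst] at h
      rw [hV, hVb, ← List.flatMap_append, List.flatMap_append, List.length_append]
      simp only [offw, List.length_append, if_true, Bool.false_eq_true, if_false, List.length_nil,
        List.length_cons] at h hl ⊢
      omega

/-! ### Elements of X_φ -/

theorem substPow_phi_ne (k : ℕ) (b : Fin 4) : 1 ≤ (substPow phi k b).length := by
  induction k generalizing b with
  | zero => simp [substPow]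
  | succ k ih =>
    have : phi b = 0 :: (phi b).tail := by revert b; decide
    rw [substPow, this, List.flatMap_cons, List.length_append]
    have := ih 0
    omega

theorem phi_deep (m : ℕ) : ∃ l r, substPow phi (2 * m) 0 = l ++ [0] ++ r ∧
    m ≤ l.length ∧ m ≤ r.length := by
  induction m with
  | zero => exact ⟨[], [], by simp [substPow], by simp, by simp⟩
  | succ m ih =>
    obtain ⟨l, r, h, hl, hr⟩ := ih
    have e : substPow phi 2 0 = [0, 1, 2, 3] ++ [0] ++ [1, 3, 2, 0, 1, 2, 3, 2, 0, 1, 3] := by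
      decide
    refine ⟨[0, 1, 2, 3].flatMap (substPow phi (2 * m)) ++ l,
      r ++ [1, 3, 2, 0, 1, 2, 3, 2, 0, 1, 3].flatMap (substPow phi (2 * m)), ?_, ?_, ?_⟩
    · rw [show 2 * (m + 1) = 2 + 2 * m by ring, substPow_add, e, List.flatMap_append,
        List.flatMap_append, List.flatMap_singleton, h]
      simp only [List.append_assoc]
    · have := substPow_phi_ne (2 * m) 0
      simp only [List.length_append, List.flatMap_cons]
      omega
    · have := substPow_phi_ne (2 * m) 1
      simp only [List.length_append, List.flatMap_cons]
      omega

theorem phi_pow_deep (k m : ℕ) : ∃ K l r, substPow phi K 0 = l ++ substPow phi k 0 ++ r ∧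
    m ≤ l.length ∧ m ≤ r.length := by
  obtain ⟨l, r, h, hl, hr⟩ := phi_deep m
  have hlen : ∀ w : List (Fin 4), w.length ≤ (w.flatMap (substPow phi k)).length := by
    intro w
    induction w with
    | nil => simp
    | cons b w ih =>
      have := substPow_phi_ne k b
      rw [List.flatMap_cons, List.length_append, List.length_cons]
      omega
  refine ⟨2 * m + k, l.flatMap (substPow phi k), r.flatMap (substPow phi k), ?_, ?_, ?_⟩
  · rw [substPow_add, h]; simp
  · exact hl.trans (hlen l)
  · exact hr.trans (hlen r)

theorem exists_phi_point (k : ℕ) : ∃ y ∈ substShift phi,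
    seqWord y 0 (substPow phi k 0).length = substPow phi k 0 := by
  set u := substPow phi k 0 with hu
  let T : ℕ → Set (ℤ → Fin 4) := fun j =>
    {y | ∃ (m : ℕ) (a : Fin 4), (seqWord y (-(j : ℤ)) (2 * j + u.length)).IsInfix
      (substPow phi m a)} ∩ {y | seqWord y 0 u.length = u}
  have hclosed : ∀ j, IsClosed (T j) := fun j =>
    (isClosed_word _ _ (fun w => ∃ (m : ℕ) (a : Fin 4), w.IsInfix (substPow phi m a))).inter
      (isClosed_word _ _ (fun w => w = u))
  have hne : ∀ j, (T j).Nonempty := by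
    intro j
    obtain ⟨K, l, r, h, hl, hr⟩ := phi_pow_deep k j
    rw [← hu] at h
    let y : ℤ → Fin 4 := fun i => (substPow phi K 0).getD (i + l.length).toNat 0
    have hy : seqWord y (-(l.length : ℤ)) (substPow phi K 0).length = substPow phi K 0 := by
      rw [seqWord_eq_iff]
      intro i hi
      have e : (-(l.length : ℤ) + i + l.length).toNat = i := by omega
      simp only [y, e]
      rw [List.getD_eq_getElem _ _ hi]
    have hlen : (substPow phi K 0).length = l.length + u.length + r.length := by rw [h]; simp [add_assoc]
    refine ⟨y, ⟨K, 0, ?_⟩, ?_⟩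
    · have := seqWord_isub y (-(j : ℤ)) (-(l.length : ℤ)) (2 * j + u.length)
        (substPow phi K 0).length (by omega) (by rw [hlen]; push_cast; omega)
      rwa [hy] at this
    · rw [hlen, seqWord_add, seqWord_add, h] at hy
      have h1 := (List.append_inj hy (by simp [seqWord_length])).1
      have h2 := (List.append_inj h1 (by simp [seqWord_length])).2
      simpa using h2
  have hmono : ∀ j, T (j + 1) ⊆ T j := by
    rintro j y ⟨⟨m, a, h⟩, h2⟩
    refine ⟨⟨m, a, List.IsInfix.trans ?_ h⟩, h2⟩
    apply seqWord_isub
    · push_cast; omega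
    · push_cast; omega
  obtain ⟨y, hy⟩ := IsCompact.nonempty_iInter_of_sequence_nonempty_isCompact_isClosed T hmono hne
    (hclosed 0).isCompact hclosed
  rw [Set.mem_iInter] at hy
  refine ⟨y, ?_, (hy 0).2⟩
  intro i n
  obtain ⟨m, a, h⟩ := (hy (i.natAbs + n)).1
  refine ⟨m, a, List.IsInfix.trans ?_ h⟩
  have := le_abs_self i
  have := neg_abs_le i
  apply seqWord_isub
  · push_cast; omega
  · push_cast; omega

/-! ### The decoding map -/

/-- The bi-infinite decoding map. -/
def GG (z : ℤ → Fin 5) : ℤ → Fin 2 := Classical.choose (exists_concat rho_ne z)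

theorem GG_spec (z : ℤ → Fin 5) : ∃ s, ConcatS rho z (GG z) s :=
  Classical.choose_spec (exists_concat rho_ne z)

theorem GG_shift {z : ℤ → Fin 5} {s : ℤ → ℤ} (h : ConcatS rho z (GG z) s) (n : ℤ) :
    GG (shiftZ n z) = shiftZ (s n) (GG z) := by
  obtain ⟨s', h'⟩ := GG_spec (shiftZ n z)
  exact h'.unique rho_ne (h.shift n)

theorem GG_continuous : Continuous GG := by
  apply continuous_pi
  intro m
  rw [continuous_discrete_rng]
  intro b
  apply isOpen_of_local _ |m|
  intro x y hxy hx
  obtain ⟨s, hs⟩ := GG_spec x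
  obtain ⟨s', hs'⟩ := GG_spec y
  have := hs.agree rho_ne hs' |m| hxy m le_rfl
  simp only [Set.mem_preimage, Set.mem_singleton_iff] at hx ⊢
  rw [← this, hx]

theorem GG_mem {z : ℤ → Fin 5} (hz : z ∈ Yspace) : GG z ∈ substShift theta := by
  have hcl : IsClosed (GG ⁻¹' substShift theta) := (isClosed_substShift theta).preimage GG_continuous
  refine closure_minimal ?_ hcl hz
  rintro z ⟨y, hy, w, hw, n, rfl⟩
  rw [isConcat_iff] at hw
  obtain ⟨s, hs⟩ := hw
  obtain ⟨t, ht⟩ := GG_spec w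
  rw [Set.mem_preimage, GG_shift ht]
  apply substShift_shiftZ
  intro i m
  obtain ⟨i1, n1, h1⟩ := ht.cover rho_ne i m
  obtain ⟨i2, n2, h2⟩ := hs.cover psi_ne i1 n1
  obtain ⟨k, b, h3⟩ := hy i2 n2
  have h4 := flatMap_isub rho (h2.trans (flatMap_isub psi h3))
  rw [rho_psi_pow] at h4
  have h5 := flatMap_isub (substPow theta (2 * k + 3)) (tau_isub b)
  rw [← substPow_add] at h5
  exact ⟨_, 0, h1.trans (h4.trans h5)⟩

/-! ### Windows -/

/-- Allowed windows of length five. -/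
def Pwin (l : List (Fin 5)) : Prop :=
  ∃ a b : Fin 4, ∃ j < (psi a).length, l = ((psi a ++ psi b).drop j).take 5

theorem seqWord_drop {A : Type} (x : ℤ → A) (i : ℤ) (n j : ℕ) :
    (seqWord x i n).drop j = seqWord x (i + j) (n - j) := by
  apply List.ext_getElem
  · simp [seqWord_length]
  · intro k h1 h2
    rw [List.getElem_drop, seqWord_get, seqWord_get]
    congr 1; push_cast; ring

theorem seqWord_take {A : Type} (x : ℤ → A) (i : ℤ) (n j : ℕ) :
    (seqWord x i n).take j = seqWord x i (min j n) := by
  apply List.ext_getElem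
  · simp [seqWord_length]
  · intro k h1 h2
    rw [List.getElem_take, seqWord_get, seqWord_get]

theorem Y_win {z : ℤ → Fin 5} (hz : z ∈ Yspace) (i : ℤ) : Pwin (seqWord z i 5) := by
  have hcl : IsClosed {z : ℤ → Fin 5 | ∀ i, Pwin (seqWord z i 5)} := by
    rw [Set.ofPred_forall]
    exact isClosed_iInter fun i => isClosed_word i 5 Pwin
  refine closure_minimal ?_ hcl hz i
  rintro z ⟨y, hy, w, hw, n, rfl⟩ i
  rw [isConcat_iff] at hw
  obtain ⟨s, hs⟩ := hw
  rw [seqWord_shiftZ]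
  generalize i + n = i
  obtain ⟨n, h1, h2, -⟩ := exists_cut (hs.strict psi_ne) hs.1 i
  have h3 := hs.2.1 n
  have hb : 8 ≤ (psi (y (n + 1))).length := by
    generalize y (n + 1) = b
    revert b; decide
  refine ⟨y n, y (n + 1), (i - s n).toNat, by omega, ?_⟩
  have h4 := hs.word n 2
  have e : (seqWord y n 2).flatMap psi = psi (y n) ++ psi (y (n + 1)) := by
    rw [seqWord_succ, seqWord_one]; simp
  rw [e] at h4
  rw [← h4, seqWord_drop, seqWord_take]
  congr 1
  · omega
  · rw [List.length_append]; omega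

/-- The word θ³(a). -/
def TT : List (Fin 2) := [0, 1, 0, 0, 0, 1, 0, 1]

theorem win_check : ∀ a b : Fin 4, ∀ j < (psi a).length,
    (fun l : List (Fin 5) => (fun (full : List (Fin 2)) (d : ℕ) (c : Fin 5) =>
      1 ≤ d ∧ d ≤ full.length ∧
      (c = 0 ↔ (full.drop d).take 8 = TT.take (full.length - d)) ∧
      (c = 0 → 8 ≤ full.length - d) ∧
      (c = 3 ↔ (full.drop (d - 1)).take 8 = TT.take (full.length - (d - 1))) ∧
      (c = 3 → 8 ≤ full.length - (d - 1)))
      (l.flatMap rho) (rho (l.getD 0 0)).length (l.getD 1 0))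
    (((psi a ++ psi b).drop j).take 5) := by
  set_option maxRecDepth 100000 in
  decide

theorem compare_word (x : ℤ → Fin 2) (i i' : ℤ) (n d : ℕ) (hi : i' = i + d) (c : Prop)
    (h1 : c ↔ ((seqWord x i n).drop d).take 8 = TT.take (n - d)) (h2 : c → 8 ≤ n - d) :
    seqWord x i' 8 = TT ↔ c := by
  subst hi
  rw [seqWord_drop, seqWord_take] at h1
  constructor
  · intro h
    rw [h1, ← h, seqWord_take]
    congr 1
    exact min_comm _ _
  · intro h
    have h3 := h1.1 h
    have h4 := h2 h
    rw [min_eq_left h4, List.take_of_length_le (by simpa [TT] using h4)] at h3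
    exact h3

theorem key_AD {z : ℤ → Fin 5} {s : ℤ → ℤ} (hz : z ∈ Yspace) (h : ConcatS rho z (GG z) s)
    (n : ℤ) : (seqWord (GG z) (s n) 8 = TT ↔ z n = 0) ∧
      (seqWord (GG z) (s n - 1) 8 = TT ↔ z n = 3) := by
  have hw := h.word (n - 1) 5
  obtain ⟨a, b, j, hj, hl⟩ := Y_win hz (n - 1)
  have hc := win_check a b j hj
  rw [← hl] at hc
  have e1 : (seqWord z (n - 1) 5).getD 0 0 = z (n - 1) := by simp [seqWord]
  have e2 : (seqWord z (n - 1) 5).getD 1 0 = z n := by simp [seqWord]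
  simp only [e1, e2] at hc
  obtain ⟨hd1, hd2, k1, k2, k3, k4⟩ := hc
  have hs := h.2.1 (n - 1)
  rw [sub_add_cancel] at hs
  set N := ((seqWord z (n - 1) 5).flatMap rho).length with hN
  rw [← hw] at k1 k3
  exact ⟨compare_word _ _ _ _ _ hs _ k1 k2, compare_word _ _ _ _ _ (by omega) _ k3 k4⟩

theorem jump_GG {z : ℤ → Fin 5} (hz : z ∈ Yspace) : jump (GG z) = (rho (z 0)).length := by
  obtain ⟨s, h⟩ := GG_spec z
  obtain ⟨k1, k2⟩ := key_AD hz h 0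
  rw [h.1] at k1 k2
  have hX := GG_mem hz
  have hA : GG z ∈ Aset ↔ z 0 = 0 := by
    rw [← k1]
    exact ⟨fun h => h.2, fun h => ⟨hX, h⟩⟩
  have hD : GG z ∈ shiftMap '' Aset ↔ z 0 = 3 := by
    rw [← k2]
    constructor
    · rintro ⟨x, hx, hxz⟩
      rw [← hxz, shiftMap_eq, seqWord_shiftZ]
      exact hx.2
    · intro hT
      refine ⟨shiftZ (-1) (GG z), ⟨substShift_shiftZ hX _, ?_⟩, ?_⟩
      · rw [seqWord_shiftZ]; exact hT
      · rw [shiftMap_eq, shiftZ_shiftZ]; exact shiftZ_zero _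
  unfold jump
  simp only [hA, hD]
  generalize z 0 = c
  revert c
  decide

theorem Sspeed_GG {z : ℤ → Fin 5} (hz : z ∈ Yspace) : Sspeed (GG z) = GG (shiftMap z) := by
  obtain ⟨s, h⟩ := GG_spec z
  rw [Sspeed, shiftMap_iterate, jump_GG hz, shiftMap_eq, GG_shift h]
  have := h.2.1 0
  rw [h.1] at this
  simp only [zero_add] at this
  rw [this]

theorem continuous_shiftZ {k : ℕ} (n : ℤ) : Continuous (shiftZ n : (ℤ → Fin k) → ℤ → Fin k) :=
  continuous_pi fun m => continuous_apply (m + n)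

theorem Y_shift {z : ℤ → Fin 5} (hz : z ∈ Yspace) (n : ℤ) : shiftZ n z ∈ Yspace := by
  have hm : Set.MapsTo (shiftZ n) {z | ∃ y ∈ substShift phi, ∃ w : ℤ → Fin 5,
    IsConcat psi y w ∧ ∃ n : ℤ, z = shiftZ n w} {z | ∃ y ∈ substShift phi, ∃ w : ℤ → Fin 5,
    IsConcat psi y w ∧ ∃ n : ℤ, z = shiftZ n w} := by
    rintro z ⟨y, hy, w, hw, m, rfl⟩
    exact ⟨y, hy, w, hw, n + m, shiftZ_shiftZ _ _ _⟩
  exact hm.closure (continuous_shiftZ n) hz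

/-! ### Injectivity -/

theorem inj_step {z z' : ℤ → Fin 5} (hz : z ∈ Yspace) (hz' : z' ∈ Yspace) (he : GG z = GG z') :
    z 0 = z' 0 ∧ GG (shiftZ 1 z) = GG (shiftZ 1 z') ∧ GG (shiftZ (-1) z) = GG (shiftZ (-1) z') := by
  obtain ⟨s, h⟩ := GG_spec z
  obtain ⟨s', h'⟩ := GG_spec z'
  have a0 := key_AD hz h 0
  have b0 := key_AD hz' h' 0
  have a1 := key_AD hz h (-1)
  have b1 := key_AD hz' h' (-1)
  have a2 := h.2.1 (-1)
  have b2 := h'.2.1 (-1)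
  have a3 := h.2.2 0
  have b3 := h'.2.2 0
  have hsh := GG_shift h (-1)
  have hsh' := GG_shift h' (-1)
  rw [← he] at b0 b1 b3 hsh'
  rw [h.1] at a0 a3
  rw [h'.1] at b0 b3
  rw [neg_add_cancel] at a2 b2
  rw [h.1] at a2
  rw [h'.1] at b2
  refine ⟨?_, ?_, ?_⟩
  · have c1 : z 0 = 0 ↔ z' 0 = 0 := a0.1.symm.trans b0.1
    have c2 : z 0 = 3 ↔ z' 0 = 3 := a0.2.symm.trans b0.2
    have key : ∀ b c : Fin 5, (b = 0 ↔ c = 0) → (b = 3 ↔ c = 3) →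
        (rho b).length = (rho c).length ∧ (rho b = rho c → b = c) := by decide
    obtain ⟨k1, k2⟩ := key _ _ c1 c2
    apply k2
    rw [← a3, ← b3, k1]
  · rw [← shiftMap_eq, ← shiftMap_eq, ← Sspeed_GG hz, ← Sspeed_GG hz', he]
  · rw [hsh, hsh']
    congr 1
    have hex : ¬ (seqWord (GG z) (-3) 8 = TT ∧ seqWord (GG z) (-2) 8 = TT) := by
      rintro ⟨h1, h2⟩
      have h3 := (seqWord_eq_iff _ _ TT).1 h1 1 (by decide)
      have h4 := (seqWord_eq_iff _ _ TT).1 h2 0 (by decide)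
      norm_num [TT] at h3 h4
      rw [h3] at h4
      exact absurd h4 (by decide)
    have hcases : ∀ c : Fin 5, (c = 0 ∧ (rho c).length = 3) ∨ (c = 3 ∧ (rho c).length = 1) ∨
      (c ≠ 0 ∧ c ≠ 3 ∧ (rho c).length = 2) := by decide
    rcases hcases (z (-1)) with ⟨e, l⟩ | ⟨e, l⟩ | ⟨e1, e2, l⟩ <;>
    rcases hcases (z' (-1)) with ⟨e', l'⟩ | ⟨e', l'⟩ | ⟨e1', e2', l'⟩ <;>
    rw [l] at a2 <;> rw [l'] at b2 <;>
    (push_cast at a2 b2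
     first
      | omega
      | exfalso)
    · rw [show s (-1) = -3 by omega] at a1
      rw [show s' (-1) - 1 = -2 by omega] at b1
      exact hex ⟨a1.1.2 e, b1.2.2 e'⟩
    · rw [show s (-1) = -3 by omega] at a1
      rw [show s' (-1) - 1 = -3 by omega] at b1
      exact e2' (b1.2.1 (a1.1.2 e))
    · rw [show s (-1) - 1 = -2 by omega] at a1
      rw [show s' (-1) = -3 by omega] at b1
      exact hex ⟨b1.1.2 e', a1.2.2 e⟩
    · rw [show s (-1) - 1 = -2 by omega] at a1
      rw [show s' (-1) = -2 by omega] at b1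
      exact e1' (b1.1.1 (a1.2.2 e))
    · rw [show s (-1) - 1 = -3 by omega] at a1
      rw [show s' (-1) = -3 by omega] at b1
      exact e2 (a1.2.1 (b1.1.2 e'))
    · rw [show s (-1) = -2 by omega] at a1
      rw [show s' (-1) - 1 = -2 by omega] at b1
      exact e1 (a1.1.1 (b1.2.2 e'))

theorem GG_inj {z z' : ℤ → Fin 5} (hz : z ∈ Yspace) (hz' : z' ∈ Yspace) (he : GG z = GG z') :
    z = z' := by
  have key : ∀ n : ℤ, GG (shiftZ n z) = GG (shiftZ n z') := by
    intro n
    induction n using Int.induction_on with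
    | zero => rw [shiftZ_zero, shiftZ_zero, he]
    | succ i ih =>
      have := (inj_step (Y_shift hz _) (Y_shift hz' _) ih).2.1
      rwa [shiftZ_shiftZ, shiftZ_shiftZ, add_comm] at this
    | pred i ih =>
      have := (inj_step (Y_shift hz _) (Y_shift hz' _) ih).2.2
      rwa [shiftZ_shiftZ, shiftZ_shiftZ, add_comm, ← sub_eq_add_neg] at this
  funext n
  have := (inj_step (Y_shift hz n) (Y_shift hz' n) (key n)).1
  simpa [shiftZ] using this

/-! ### Surjectivity -/

theorem approx {x : ℤ → Fin 2} (hx : x ∈ substShift theta) (N : ℕ) :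
    ∃ z ∈ Yspace, ∀ i : ℤ, |i| ≤ N → GG z i = x i := by
  obtain ⟨k, c, h⟩ := hx (-N) (2 * N + 1)
  obtain ⟨l, r, hV⟩ := h.trans (theta_pow_isub k c)
  set V := substPow theta (2 * k + 3) 0 with hVdef
  have hlen := congrArg List.length hV
  simp only [List.length_append, seqWord_length] at hlen
  obtain ⟨q, e, r', hq, hW, hql⟩ := exists_start k (l.length + N) (by rw [← hVdef]; omega)
  rw [← hVdef] at hW
  obtain ⟨y, hy, hyw⟩ := exists_phi_point k
  obtain ⟨w, s, hw⟩ := exists_concat psi_ne y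
  obtain ⟨t, ht⟩ := GG_spec w
  have hw1 := hw.word 0 (substPow phi k 0).length
  rw [hyw, hw.1] at hw1
  set W := (substPow phi k 0).flatMap psi with hWdef
  have ht1 := ht.word 0 W.length
  rw [hw1, ht.1, hW] at ht1
  obtain ⟨q2, hq2⟩ := hq
  have hpos := ht.pos_add 0 q.length
  have hwq : seqWord w 0 q.length = q := by
    rw [← hq2, List.length_append, seqWord_add] at hw1
    exact (List.append_inj hw1 (by simp [seqWord_length])).1
  rw [hwq, ht.1, hql, zero_add, zero_add] at hpos
  refine ⟨shiftZ q.length w, subset_closure ⟨y, hy, w, (isConcat_iff _ _ _).2 ⟨s, hw⟩, _, rfl⟩, ?_⟩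
  intro i hi
  rw [abs_le] at hi
  rw [GG_shift ht, hpos]
  have hword : seqWord (GG w) (e.length + l.length : ℕ) (2 * N + 1) =
      seqWord x (-N) (2 * N + 1) := by
    have e1 : e ++ V ++ r' = (e ++ l) ++ seqWord x (-N) (2 * N + 1) ++ (r ++ r') := by
      rw [← hV]; simp
    rw [e1, List.length_append, List.length_append, seqWord_add, seqWord_add] at ht1
    have h1 := (List.append_inj ht1 (by simp [seqWord_length, add_assoc])).1
    have h2 := (List.append_inj h1 (by simp [seqWord_length])).2
    simpa [seqWord_length] using h2
  have hj : (i + N).toNat < (seqWord (GG w) (e.length + l.length : ℕ) (2 * N + 1)).length := by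
    rw [seqWord_length]; omega
  have g1 := seqWord_get _ _ _ _ hj
  have g2 := seqWord_get x (-N) (2 * N + 1) (i + N).toNat (by rw [seqWord_length]; omega)
  simp only [hword] at g1
  rw [g1] at g2
  simp only [shiftZ]
  convert g2 using 2
  · push_cast; omega
  · omega

theorem isCompact_Y : IsCompact Yspace := isClosed_closure.isCompact

theorem GG_surj {x : ℤ → Fin 2} (hx : x ∈ substShift theta) : ∃ z ∈ Yspace, GG z = x := by
  have hcl : IsClosed (GG '' Yspace) := (isCompact_Y.image GG_continuous).isClosed
  by_contra hc
  have hU : (GG '' Yspace)ᶜ ∈ 𝓝 x := hcl.isOpen_compl.mem_nhds hc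
  choose z hz hzx using approx hx
  have ht : Filter.Tendsto (fun N => GG (z N)) Filter.atTop (𝓝 x) := by
    rw [tendsto_pi_nhds]
    intro i
    apply tendsto_const_nhds.congr'
    filter_upwards [Filter.eventually_ge_atTop i.natAbs] with N hN
    rw [hzx N i (by rw [Int.abs_eq_natAbs]; exact_mod_cast hN)]
  obtain ⟨N, hN⟩ := (ht.eventually hU).exists
  exact hN ⟨z N, hz N, rfl⟩

/-- the speedup (X_θ, S) is topologically conjugate to (Y, σ). -/
theorem statement2 : TopConj (substShift theta) Sspeed Yspace shiftMap := by
  have hS : Set.MapsTo Sspeed (substShift theta) (substShift theta) := by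
    intro x hx
    rw [Sspeed, shiftMap_iterate]
    exact substShift_shiftZ hx _
  have hR : Set.MapsTo (shiftMap : (ℤ → Fin 5) → _) Yspace Yspace := fun z hz => Y_shift hz 1
  let g : Yspace → substShift theta := fun z => ⟨GG z, GG_mem z.2⟩
  have hg : Continuous g := (GG_continuous.comp continuous_subtype_val).subtype_mk _
  have hbij : Function.Bijective g := by
    constructor
    · intro z z' h
      exact Subtype.ext (GG_inj z.2 z'.2 (congrArg Subtype.val h))
    · intro x
      obtain ⟨z, hz, h⟩ := GG_surj x.2
      exact ⟨⟨z, hz⟩, Subtype.ext h⟩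
  have : CompactSpace Yspace := isCompact_iff_compactSpace.1 isCompact_Y
  let e : Yspace ≃ₜ substShift theta :=
    Continuous.homeoOfEquivCompactToT2 (f := Equiv.ofBijective g hbij) hg
  refine ⟨hS, hR, e.symm, ?_⟩
  intro x
  rw [Homeomorph.symm_apply_eq]
  obtain ⟨z, rfl⟩ := e.surjective x
  rw [Homeomorph.symm_apply_apply]
  apply Subtype.ext
  exact Sspeed_GG z.2

end
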